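/- Let Y = (y_1,…,y_T) be an optimal schedule for P_k (the discrete data-center optimization problem restricted to states that are multiples of 2^k). Then there exists an optimal schedule X* = (x*_1,…,x*_T) for the continuous extension P̄ such that for every t ∈ {1,…,T} satisfying |y_t − x*_t| ≥ 2^k or |y_{t−1} − x*_{t−1}| ≥ 2^k, one has (y_t − y_{t−1})·(x*_t − x*_{t−1}) ≥ 0 (with y_0 = x*_0 = 0). -/

import Mathlib

open Finset

noncomputable section

/-- Feasibility of a discrete schedule for time horizon `T` with `m` servers:
`x 0 = 0` and `x t ∈ {0, …, m}` for `t ∈ {1, …, T}`. -/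
def DFeasible (T m : ℕ) (x : ℕ → ℕ) : Prop :=
  x 0 = 0 ∧ ∀ t ∈ Finset.Icc 1 T, x t ≤ m

/-- Cost of a discrete schedule:
`C(X) = ∑_{t=1}^T f_t(x_t) + β ∑_{t=1}^T (x_t - x_{t-1})⁺`. -/
def DCost (T : ℕ) (β : ℝ) (f : ℕ → ℕ → ℝ) (x : ℕ → ℕ) : ℝ :=
  ∑ t ∈ Finset.Icc 1 T, f t (x t)
    + β * ∑ t ∈ Finset.Icc 1 T, max ((x t : ℝ) - (x (t - 1) : ℝ)) 0

/-- Optimality for the problem `P_k`: the schedule is feasible, all its states are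
multiples of `2 ^ k`, and it minimizes the cost among all such schedules. -/
def DOptimalK (T m : ℕ) (β : ℝ) (f : ℕ → ℕ → ℝ) (k : ℕ) (x : ℕ → ℕ) : Prop :=
  DFeasible T m x ∧ (∀ t ∈ Finset.Icc 1 T, 2 ^ k ∣ x t) ∧
    ∀ y : ℕ → ℕ, DFeasible T m y → (∀ t ∈ Finset.Icc 1 T, 2 ^ k ∣ y t) →
      DCost T β f x ≤ DCost T β f y

/-- Linear interpolation of `f : ℕ → ℝ` to real arguments:
`f̄(x) = (⌈x⌉ - x)·f(⌊x⌋) + (x - ⌊x⌋)·f(⌈x⌉)` (and `f̄(x) = f(x)` at integers). -/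
def interp (f : ℕ → ℝ) (x : ℝ) : ℝ :=
  (1 - (x - (⌊x⌋₊ : ℝ))) * f ⌊x⌋₊ + (x - (⌊x⌋₊ : ℝ)) * f (⌊x⌋₊ + 1)

/-- Feasibility of a fractional schedule: `x 0 = 0` and `x t ∈ [0, m]`. -/
def CFeasible (T m : ℕ) (x : ℕ → ℝ) : Prop :=
  x 0 = 0 ∧ ∀ t ∈ Finset.Icc 1 T, x t ∈ Set.Icc (0 : ℝ) m

/-- Cost of a fractional schedule in the continuous extension `P̄`. -/
def CCost (T : ℕ) (β : ℝ) (f : ℕ → ℕ → ℝ) (x : ℕ → ℝ) : ℝ :=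
  ∑ t ∈ Finset.Icc 1 T, interp (f t) (x t)
    + β * ∑ t ∈ Finset.Icc 1 T, max (x t - x (t - 1)) 0

/-- Optimality for the continuous extension `P̄`. -/
def COptimal (T m : ℕ) (β : ℝ) (f : ℕ → ℕ → ℝ) (x : ℕ → ℝ) : Prop :=
  CFeasible T m x ∧ ∀ y : ℕ → ℝ, CFeasible T m y → CCost T β f x ≤ CCost T β f y

open MeasureTheory in
/-- Rounding `z` with a uniformly random threshold has expected value `interp h z`. -/
lemma integrable_floor_and_integral (h : ℕ → ℝ) {z : ℝ} (hz : 0 ≤ z) :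
    Integrable (fun θ : ℝ => h ⌊z + θ⌋₊) (volume.restrict (Set.Ico (0 : ℝ) 1)) ∧
      ∫ θ in Set.Ico (0 : ℝ) 1, h ⌊z + θ⌋₊ = interp h z := by
  set n := ⌊z⌋₊ with hn
  have h1 : (n : ℝ) ≤ z := Nat.floor_le hz
  have h2 : z < n + 1 := Nat.lt_floor_add_one z
  set S : Set ℝ := Set.Ico (n + 1 - z) 1 with hS
  have hSm : MeasurableSet S := measurableSet_Ico
  have hae : (fun θ : ℝ => h ⌊z + θ⌋₊) =ᵐ[volume.restrict (Set.Ico (0 : ℝ) 1)]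
      fun θ => h n + S.indicator (fun _ => h (n + 1) - h n) θ := by
    refine ae_restrict_of_forall_mem measurableSet_Ico fun θ hθ => ?_
    by_cases hc : θ ∈ S
    · have : ⌊z + θ⌋₊ = n + 1 := by
        rw [Nat.floor_eq_iff (by linarith [hθ.1])]
        push_cast
        constructor <;> linarith [hc.1, hθ.2]
      simp [this, hc]
    · have hlt : θ < n + 1 - z := by
        by_contra hge
        exact hc ⟨not_lt.mp hge, hθ.2⟩
      have : ⌊z + θ⌋₊ = n := by
        rw [Nat.floor_eq_iff (by linarith [hθ.1])]
        constructor <;> linarith [hθ.1]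
      simp [this, hc]
  have hi1 : Integrable (fun _ : ℝ => h n) (volume.restrict (Set.Ico (0 : ℝ) 1)) :=
    integrable_const _
  have hi2 : Integrable (S.indicator (fun _ : ℝ => h (n + 1) - h n))
      (volume.restrict (Set.Ico (0 : ℝ) 1)) := (integrable_const _).indicator hSm
  refine ⟨(hi1.add hi2).congr hae.symm, ?_⟩
  rw [integral_congr_ae hae, integral_add hi1 hi2, integral_indicator hSm,
    Measure.restrict_restrict hSm]
  have hinter : S ∩ Set.Ico (0 : ℝ) 1 = S :=
    Set.inter_eq_left.mpr (Set.Ico_subset_Ico_left (by linarith))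
  rw [hinter, setIntegral_const, setIntegral_const, hS, Real.volume_real_Ico_of_le (by linarith),
    Real.volume_real_Ico_of_le (by linarith), interp, ← hn]
  simp only [smul_eq_mul]
  ring

lemma interp_natCast_fun (z : ℝ) : interp (fun n => (n : ℝ)) z = z := by
  simp only [interp]
  push_cast
  ring

lemma interp_natCast (h : ℕ → ℝ) (n : ℕ) : interp h n = h n := by
  simp [interp]

open MeasureTheory in
lemma integrable_floor_sub_and_integral {a b : ℝ} (ha : 0 ≤ a) (hb : 0 ≤ b) :
    Integrable (fun θ : ℝ => max ((⌊a + θ⌋₊ : ℝ) - (⌊b + θ⌋₊ : ℝ)) 0)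
        (volume.restrict (Set.Ico (0 : ℝ) 1)) ∧
      ∫ θ in Set.Ico (0 : ℝ) 1, max ((⌊a + θ⌋₊ : ℝ) - (⌊b + θ⌋₊ : ℝ)) 0 = max (a - b) 0 := by
  obtain ⟨ia, ea⟩ := integrable_floor_and_integral (fun n => (n : ℝ)) ha
  obtain ⟨ib, eb⟩ := integrable_floor_and_integral (fun n => (n : ℝ)) hb
  rw [interp_natCast_fun] at ea eb
  rcases le_total b a with hab | hab
  · have : (fun θ : ℝ => max ((⌊a + θ⌋₊ : ℝ) - (⌊b + θ⌋₊ : ℝ)) 0)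
        = fun θ => (⌊a + θ⌋₊ : ℝ) - (⌊b + θ⌋₊ : ℝ) := by
      funext θ
      have : (⌊b + θ⌋₊ : ℝ) ≤ ⌊a + θ⌋₊ := by
        exact_mod_cast Nat.floor_le_floor (by linarith)
      exact max_eq_left (by linarith)
    rw [this, max_eq_left (by linarith), integral_sub ia ib, ea, eb]
    exact ⟨ia.sub ib, rfl⟩
  · have : (fun θ : ℝ => max ((⌊a + θ⌋₊ : ℝ) - (⌊b + θ⌋₊ : ℝ)) 0) = fun _ => 0 := by
      funext θ
      have : (⌊a + θ⌋₊ : ℝ) ≤ ⌊b + θ⌋₊ := by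
        exact_mod_cast Nat.floor_le_floor (by linarith)
      exact max_eq_right (by linarith)
    rw [this, max_eq_right (by linarith)]
    simp

lemma CFeasible.pred_nonneg {T m : ℕ} {z : ℕ → ℝ} (hz : CFeasible T m z) {t : ℕ}
    (ht : t ∈ Finset.Icc 1 T) : 0 ≤ z (t - 1) := by
  rw [Finset.mem_Icc] at ht
  rcases Nat.eq_zero_or_pos (t - 1) with h | h
  · rw [h, hz.1]
  · exact (hz.2 (t - 1) (Finset.mem_Icc.mpr ⟨h, by omega⟩)).1

open MeasureTheory in
/-- Every fractional schedule can be rounded to a discrete one without increasing the cost. -/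
lemma exists_rounding (T m : ℕ) (β : ℝ) (f : ℕ → ℕ → ℝ) (z : ℕ → ℝ) (hz : CFeasible T m z) :
    ∃ x : ℕ → ℕ, DFeasible T m x ∧ DCost T β f x ≤ CCost T β f z := by
  have i1 : ∀ t ∈ Finset.Icc 1 T, _ := fun t ht =>
    integrable_floor_and_integral (f t) (hz.2 t ht).1
  have i2 : ∀ t ∈ Finset.Icc 1 T, _ := fun t ht =>
    integrable_floor_sub_and_integral (hz.2 t ht).1 (hz.pred_nonneg ht)
  have s1 := integrable_finsetSum _ fun t ht => (i1 t ht).1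
  have s2 := (integrable_finsetSum _ fun t ht => (i2 t ht).1).const_mul β
  have hint : ∫ θ in Set.Ico (0 : ℝ) 1, DCost T β f (fun t => ⌊z t + θ⌋₊) = CCost T β f z := by
    simp only [DCost, CCost]
    rw [integral_add s1 s2, integral_const_mul, integral_finsetSum _ fun t ht => (i1 t ht).1,
      integral_finsetSum _ fun t ht => (i2 t ht).1,
      Finset.sum_congr rfl fun t ht => (i1 t ht).2, Finset.sum_congr rfl fun t ht => (i2 t ht).2]
  have hvol : volume (Set.Ico (0 : ℝ) 1) = 1 := by simp
  obtain ⟨θ, hθ, hle⟩ := exists_le_setAverage (μ := volume) (s := Set.Ico (0 : ℝ) 1)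
    (f := fun θ => DCost T β f (fun t => ⌊z t + θ⌋₊)) (by simp) (by simp) (s1.add s2)
  rw [setAverage_eq, measureReal_def, hvol, hint] at hle
  refine ⟨fun t => ⌊z t + θ⌋₊, ⟨?_, fun t ht => ?_⟩, by simpa using hle⟩
  · simp [hz.1, Nat.floor_eq_zero, hθ.2]
  · have := (hz.2 t ht).2
    refine Nat.lt_succ_iff.mp ((Nat.floor_lt (by linarith [(hz.2 t ht).1, hθ.1])).mpr ?_)
    push_cast
    linarith [hθ.2]

/-- A discrete schedule minimizing `DCost` among all discrete schedules. -/
def DOptimal (T m : ℕ) (β : ℝ) (f : ℕ → ℕ → ℝ) (x : ℕ → ℕ) : Prop :=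
  DFeasible T m x ∧ ∀ y, DFeasible T m y → DCost T β f x ≤ DCost T β f y

lemma DCost_congr {T : ℕ} {β : ℝ} {f : ℕ → ℕ → ℝ} {x x' : ℕ → ℕ} (h : ∀ t ≤ T, x t = x' t) :
    DCost T β f x = DCost T β f x' := by
  have h' : ∀ t ∈ Finset.Icc 1 T, x t = x' t ∧ x (t - 1) = x' (t - 1) := fun t ht => by
    rw [Finset.mem_Icc] at ht
    exact ⟨h _ ht.2, h _ (by omega)⟩
  simp only [DCost]
  congr 1
  · exact Finset.sum_congr rfl fun t ht => by rw [(h' t ht).1]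
  · congr 1
    exact Finset.sum_congr rfl fun t ht => by rw [(h' t ht).1, (h' t ht).2]

lemma exists_DOptimal (T m : ℕ) (β : ℝ) (f : ℕ → ℕ → ℝ) : ∃ x, DOptimal T m β f x := by
  let ext (p : Fin T → Fin (m + 1)) (t : ℕ) : ℕ :=
    if h : 1 ≤ t ∧ t ≤ T then p ⟨t - 1, by omega⟩ else 0
  obtain ⟨p, hp⟩ := Finite.exists_min fun p => DCost T β f (ext p)
  refine ⟨ext p, ⟨by simp [ext], fun t ht => ?_⟩, fun y hy => ?_⟩
  · have := Finset.mem_Icc.mp ht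
    simp only [ext, this, and_self, dite_true]
    omega
  · let q : Fin T → Fin (m + 1) := fun i =>
      ⟨y (i + 1), Nat.lt_succ_of_le (hy.2 _ (Finset.mem_Icc.mpr ⟨by omega, by omega⟩))⟩
    refine (hp q).trans_eq (DCost_congr fun t ht => ?_)
    rcases Nat.eq_zero_or_pos t with rfl | h
    · simp [ext, hy.1]
    · have h' : 1 ≤ t ∧ t ≤ T := ⟨h, ht⟩
      simp [ext, h', q, Nat.sub_add_cancel h]

lemma CCost_natCast (T : ℕ) (β : ℝ) (f : ℕ → ℕ → ℝ) (x : ℕ → ℕ) :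
    CCost T β f (fun t => (x t : ℝ)) = DCost T β f x := by
  simp only [CCost, DCost, interp_natCast]

lemma DOptimal.le_CCost {T m : ℕ} {β : ℝ} {f : ℕ → ℕ → ℝ} {x : ℕ → ℕ} (hx : DOptimal T m β f x)
    {z : ℕ → ℝ} (hz : CFeasible T m z) : DCost T β f x ≤ CCost T β f z := by
  obtain ⟨w, hw, hle⟩ := exists_rounding T m β f z hz
  exact (hx.2 w hw).trans hle

lemma DOptimal.cOptimal {T m : ℕ} {β : ℝ} {f : ℕ → ℕ → ℝ} {x : ℕ → ℕ} (hx : DOptimal T m β f x) :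
    COptimal T m β f (fun t => (x t : ℝ)) := by
  refine ⟨⟨by simp [hx.1.1], fun t ht => ⟨by positivity, Nat.cast_le.mpr (hx.1.2 t ht)⟩⟩,
    fun z hz => ?_⟩
  rw [CCost_natCast]
  exact hx.le_CCost hz

/-- Linear interpolation of `f` between the multiples of `N`, at natural arguments. -/
def coarse (N : ℕ) (f : ℕ → ℝ) (v : ℕ) : ℝ := interp (fun i => f (N * i)) (v / N)

lemma coarse_eq {N : ℕ} (hN : 0 < N) (f : ℕ → ℝ) {i r : ℕ} (hr : r ≤ N) :
    coarse N f (N * i + r) = f (N * i) + r / N * (f (N * (i + 1)) - f (N * i)) := by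
  have hN' : (N : ℝ) ≠ 0 := by positivity
  have hdiv : ((N * i + r : ℕ) : ℝ) / N = i + r / N := by
    push_cast
    field_simp
  rcases hr.eq_or_lt with rfl | hr
  · have : ((r * i + r : ℕ) : ℝ) / r = (i + 1 : ℕ) := by
      rw [hdiv, div_self hN']
      push_cast
      ring
    rw [coarse, this, interp_natCast, div_self hN']
    ring
  · have hfl : ⌊((N * i + r : ℕ) : ℝ) / N⌋₊ = i := by
      rw [Nat.floor_div_natCast, Nat.floor_natCast]
      rw [Nat.mul_add_div hN, Nat.div_eq_of_lt hr, add_zero]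
    rw [coarse, interp, hfl, hdiv]
    ring

lemma coarse_mul {N : ℕ} (hN : 0 < N) (f : ℕ → ℝ) (i : ℕ) : coarse N f (N * i) = f (N * i) := by
  simpa using coarse_eq hN f (i := i) (Nat.zero_le N)

lemma coarse_succ_sub {N : ℕ} (hN : 0 < N) (f : ℕ → ℝ) (v : ℕ) :
    coarse N f (v + 1) - coarse N f v
      = (f (N * (v / N + 1)) - f (N * (v / N))) / N := by
  have hv := Nat.div_add_mod v N
  have hlt := Nat.mod_lt v hN
  have e1 := coarse_eq hN f (i := v / N) hlt.le
  have e2 := coarse_eq hN f (i := v / N) (r := v % N + 1) hlt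
  rw [← add_assoc] at e2
  rw [hv] at e1 e2
  rw [e1, e2]
  push_cast
  ring

section Convex

variable {m N : ℕ} {f : ℕ → ℝ}

lemma sub_le_nsmul_slope
    (hf : ∀ a b : ℕ, a ≤ b → b + 1 ≤ m → f (a + 1) - f a ≤ f (b + 1) - f b)
    {a b n : ℕ} (h : a + n ≤ b + 1) (hb : b + 1 ≤ m) :
    f (a + n) - f a ≤ n * (f (b + 1) - f b) := by
  induction n with
  | zero => simp
  | succ n ih =>
    have h1 := ih (by omega)
    have h2 := hf (a + n) b (by omega) hb
    rw [add_assoc] at h2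
    push_cast
    linarith

lemma nsmul_slope_le_sub
    (hf : ∀ a b : ℕ, a ≤ b → b + 1 ≤ m → f (a + 1) - f a ≤ f (b + 1) - f b)
    {a b n : ℕ} (h : b ≤ a) (hb : a + n ≤ m) :
    n * (f (b + 1) - f b) ≤ f (a + n) - f a := by
  induction n with
  | zero => simp
  | succ n ih =>
    have h1 := ih (by omega)
    have h2 := hf b (a + n) (by omega) (by omega)
    rw [add_assoc] at h2
    push_cast
    linarith

lemma coarse_slope_le (hN : 0 < N)
    (hf : ∀ a b : ℕ, a ≤ b → b + 1 ≤ m → f (a + 1) - f a ≤ f (b + 1) - f b)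
    {v b : ℕ} (h : v + N ≤ b + 1) (hb : b + 1 ≤ m) :
    coarse N f (v + 1) - coarse N f v ≤ f (b + 1) - f b := by
  rw [coarse_succ_sub hN, div_le_iff₀ (by positivity), mul_comm _ (N : ℝ), mul_add_one]
  have := Nat.mul_div_le v N
  exact sub_le_nsmul_slope hf (by omega) hb

lemma le_coarse_slope (hN : 0 < N) (hNm : N ∣ m)
    (hf : ∀ a b : ℕ, a ≤ b → b + 1 ≤ m → f (a + 1) - f a ≤ f (b + 1) - f b)
    {v b : ℕ} (h : b + N ≤ v + 1) (hv : v + 1 ≤ m) :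
    f (b + 1) - f b ≤ coarse N f (v + 1) - coarse N f v := by
  rw [coarse_succ_sub hN, le_div_iff₀ (by positivity), mul_comm _ (N : ℝ), mul_add_one]
  have h1 := Nat.div_add_mod v N
  have h2 := Nat.mod_lt v hN
  obtain ⟨M, rfl⟩ := hNm
  have h3 : v / N + 1 ≤ M := Nat.div_lt_of_lt_mul (by omega)
  have h4 := Nat.mul_le_mul_left N h3
  rw [mul_add_one] at h4
  exact nsmul_slope_le_sub hf (by omega) h4

lemma coarse_exchange_above (hN : 0 < N)
    (hf : ∀ a b : ℕ, a ≤ b → b + 1 ≤ m → f (a + 1) - f a ≤ f (b + 1) - f b)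
    {x y : ℕ} (hx : x ≤ m) :
    f (min x (y + (N - 1))) + coarse N f (max y (x - (N - 1))) ≤ f x + coarse N f y := by
  rcases le_total x (y + (N - 1)) with h | h
  · rw [min_eq_left h, max_eq_left (by omega)]
  · rw [min_eq_right h, max_eq_right (by omega)]
    obtain ⟨d, rfl⟩ := Nat.exists_eq_add_of_le h
    have hd : y + (N - 1) + d - (N - 1) = y + d := by omega
    rw [hd]
    clear h hd
    induction d with
    | zero => simp
    | succ d ih =>
      have h1 := ih (by omega)
      have h2 := coarse_slope_le hN hf (v := y + d) (b := y + (N - 1) + d) (by omega) (by omega)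
      rw [← add_assoc, ← add_assoc]
      linarith

lemma coarse_exchange_below (hN : 0 < N) (hNm : N ∣ m)
    (hf : ∀ a b : ℕ, a ≤ b → b + 1 ≤ m → f (a + 1) - f a ≤ f (b + 1) - f b)
    {x y : ℕ} (hy : y ≤ m) :
    f (max x (y - (N - 1))) + coarse N f (min y (x + (N - 1))) ≤ f x + coarse N f y := by
  rcases le_total y (x + (N - 1)) with h | h
  · rw [min_eq_left h, max_eq_left (by omega)]
  · rw [min_eq_right h, max_eq_right (by omega)]
    obtain ⟨d, rfl⟩ := Nat.exists_eq_add_of_le h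
    have hd : x + (N - 1) + d - (N - 1) = x + d := by omega
    rw [hd]
    clear h hd
    induction d with
    | zero => simp
    | succ d ih =>
      have h1 := ih (by omega)
      have h2 := le_coarse_slope hN hNm hf (v := x + (N - 1) + d) (b := x + d)
        (by omega) (by omega)
      rw [← add_assoc, ← add_assoc]
      linarith

end Convex

lemma switching_exchange_above (a b p q c : ℕ) :
    max (((min a (p + c) : ℕ) : ℝ) - ((min b (q + c) : ℕ) : ℝ)) 0
        + max (((max p (a - c) : ℕ) : ℝ) - ((max q (b - c) : ℕ) : ℝ)) 0
      ≤ max ((a : ℝ) - b) 0 + max ((p : ℝ) - q) 0 := by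
  have key : max (((min a (p + c) : ℕ) : ℤ) - ((min b (q + c) : ℕ) : ℤ)) 0
        + max (((max p (a - c) : ℕ) : ℤ) - ((max q (b - c) : ℕ) : ℤ)) 0
      ≤ max ((a : ℤ) - b) 0 + max ((p : ℤ) - q) 0 := by omega
  exact_mod_cast key

lemma switching_exchange_below (a b p q c : ℕ) :
    max (((max a (p - c) : ℕ) : ℝ) - ((max b (q - c) : ℕ) : ℝ)) 0
        + max (((min p (a + c) : ℕ) : ℝ) - ((min q (b + c) : ℕ) : ℝ)) 0
      ≤ max ((a : ℝ) - b) 0 + max ((p : ℝ) - q) 0 := by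
  have := switching_exchange_above p q a b c
  linarith

/-- Cost of the schedule `v` when the operating costs are interpolated between multiples of `N`. -/
def CoarseCost (T N : ℕ) (β : ℝ) (f : ℕ → ℕ → ℝ) (v : ℕ → ℕ) : ℝ :=
  DCost T β (fun t => coarse N (f t)) v

lemma CCost_div {N : ℕ} (hN : 0 < N) (T : ℕ) (β : ℝ) (f : ℕ → ℕ → ℝ) (v : ℕ → ℕ) :
    CCost T (N * β) (fun t i => f t (N * i)) (fun t => (v t : ℝ) / N) = CoarseCost T N β f v := by
  have hN' : (0 : ℝ) < N := by positivity
  simp only [CCost, CoarseCost, DCost, coarse]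
  congr 1
  rw [mul_comm (N : ℝ) β, mul_assoc, Finset.mul_sum]
  congr 1
  refine Finset.sum_congr rfl fun t _ => ?_
  rw [mul_max_of_nonneg _ _ hN'.le, mul_zero]
  congr 1
  field_simp

/-- Optimality among multiples of `2 ^ k` persists for the interpolated cost. -/
lemma DOptimalK.le_coarseCost {T m k : ℕ} {β : ℝ} {f : ℕ → ℕ → ℝ} {y : ℕ → ℕ}
    (hy : DOptimalK T m β f k y) (hkm : 2 ^ k ∣ m) {v : ℕ → ℕ} (hv : DFeasible T m v) :
    CoarseCost T (2 ^ k) β f y ≤ CoarseCost T (2 ^ k) β f v := by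
  have hN : 0 < 2 ^ k := by positivity
  have hN' : (0 : ℝ) < ((2 ^ k : ℕ) : ℝ) := by exact_mod_cast hN
  obtain ⟨M, hM⟩ := hkm
  obtain ⟨hyf, hyd, hyo⟩ := hy
  have hyy : CoarseCost T (2 ^ k) β f y = DCost T β f y := by
    simp only [CoarseCost, DCost]
    congr 1
    refine Finset.sum_congr rfl fun t ht => ?_
    obtain ⟨i, hi⟩ := hyd t ht
    rw [hi, coarse_mul hN]
  have hvf : CFeasible T M (fun t => (v t : ℝ) / ((2 ^ k : ℕ) : ℝ)) := by
    refine ⟨by simp [hv.1], fun t ht => ⟨by positivity, ?_⟩⟩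
    rw [div_le_iff₀ hN', mul_comm]
    have := hv.2 t ht
    rw [hM] at this
    exact_mod_cast this
  obtain ⟨w, hw, hle⟩ := exists_rounding T M ((2 ^ k : ℕ) * β) (fun t i => f t (2 ^ k * i)) _ hvf
  rw [CCost_div hN] at hle
  have hwc : DCost T ((2 ^ k : ℕ) * β) (fun t i => f t (2 ^ k * i)) w
      = DCost T β f (fun t => 2 ^ k * w t) := by
    simp only [DCost]
    congr 1
    rw [mul_comm _ β, mul_assoc, Finset.mul_sum]
    congr 1
    refine Finset.sum_congr rfl fun t _ => ?_
    rw [mul_max_of_nonneg _ _ hN'.le, mul_zero, mul_sub]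
    push_cast
    rfl
  rw [hyy]
  refine le_trans (hyo _ ⟨by simp [hw.1], fun t ht => ?_⟩ fun t _ => ⟨w t, rfl⟩)
    (hwc ▸ hle)
  rw [hM]
  exact Nat.mul_le_mul_left _ (hw.2 t ht)

lemma DCost_add_le {T : ℕ} {β : ℝ} (hβ : 0 ≤ β) {f g : ℕ → ℕ → ℝ} {x y x' y' : ℕ → ℕ}
    (hop : ∀ t ∈ Finset.Icc 1 T, f t (x' t) + g t (y' t) ≤ f t (x t) + g t (y t))
    (hsw : ∀ t ∈ Finset.Icc 1 T,
      max ((x' t : ℝ) - x' (t - 1)) 0 + max ((y' t : ℝ) - y' (t - 1)) 0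
        ≤ max ((x t : ℝ) - x (t - 1)) 0 + max ((y t : ℝ) - y (t - 1)) 0) :
    DCost T β f x' + DCost T β g y' ≤ DCost T β f x + DCost T β g y := by
  have h1 := Finset.sum_le_sum hop
  have h2 := mul_le_mul_of_nonneg_left (Finset.sum_le_sum hsw) hβ
  simp only [Finset.sum_add_distrib, mul_add] at h1 h2
  simp only [DCost]
  linarith

/-- Proximity: an optimal schedule for `P_k` has an optimal discrete schedule at distance less
than `2 ^ k` in every time slot. -/
lemma DOptimalK.exists_near {T m k : ℕ} {β : ℝ} (hβ : 0 ≤ β) {f : ℕ → ℕ → ℝ}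
    (hconv : ∀ t ∈ Finset.Icc 1 T, ∀ a b : ℕ, a ≤ b → b + 1 ≤ m →
      f t (a + 1) - f t a ≤ f t (b + 1) - f t b)
    {y : ℕ → ℕ} (hy : DOptimalK T m β f k y) (hkm : 2 ^ k ∣ m) :
    ∃ x, DOptimal T m β f x ∧ ∀ t, x t < y t + 2 ^ k ∧ y t < x t + 2 ^ k := by
  have hN : 0 < 2 ^ k := by positivity
  set N := 2 ^ k
  have exchange {x x' y' : ℕ → ℕ} (hx : DOptimal T m β f x) (hx' : DFeasible T m x')
      (hy' : DFeasible T m y')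
      (hle : DCost T β f x' + CoarseCost T N β f y' ≤ DCost T β f x + CoarseCost T N β f y) :
      DOptimal T m β f x' :=
    ⟨hx', fun w hw => by linarith [hx.2 w hw, hy.le_coarseCost hkm hy']⟩
  obtain ⟨x₀, hx₀⟩ := exists_DOptimal T m β f
  set x₁ : ℕ → ℕ := fun t => min (x₀ t) (y t + (N - 1)) with hx₁def
  have hx₁ : DOptimal T m β f x₁ := by
    refine exchange (y' := fun t => max (y t) (x₀ t - (N - 1))) hx₀
      ⟨by simp [hx₁def, hx₀.1.1], fun t ht => (min_le_left _ _).trans (hx₀.1.2 t ht)⟩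
      ⟨by simp [hx₀.1.1, hy.1.1], fun t ht =>
        max_le (hy.1.2 t ht) ((Nat.sub_le _ _).trans (hx₀.1.2 t ht))⟩
      (DCost_add_le hβ (fun t ht => ?_) fun t _ => switching_exchange_above _ _ _ _ _)
    exact coarse_exchange_above hN (hconv t ht) (hx₀.1.2 t ht)
  set x₂ : ℕ → ℕ := fun t => max (x₁ t) (y t - (N - 1)) with hx₂def
  refine ⟨x₂, ?_, fun t => ?_⟩
  · refine exchange (y' := fun t => min (y t) (x₁ t + (N - 1))) hx₁
      ⟨by simp [hx₂def, hx₁.1.1, hy.1.1], fun t ht =>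
        max_le (hx₁.1.2 t ht) ((Nat.sub_le _ _).trans (hy.1.2 t ht))⟩
      ⟨by simp [hy.1.1], fun t ht => (min_le_left _ _).trans (hy.1.2 t ht)⟩
      (DCost_add_le hβ (fun t ht => ?_) fun t _ => switching_exchange_below _ _ _ _ _)
    exact coarse_exchange_below hN hkm (hconv t ht) (hy.1.2 t ht)
  · simp only [hx₂def, hx₁def]
    omega

/-- If `Y` is an optimal schedule for `P_k`, then there is an optimal
schedule `X*` for the continuous extension `P̄` such that for every `t ∈ {1,…,T}` with
`|y_t − x*_t| ≥ 2^k` or `|y_{t−1} − x*_{t−1}| ≥ 2^k` one has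
`(y_t − y_{t−1})·(x*_t − x*_{t−1}) ≥ 0`. -/
theorem stmt0 (T m K k : ℕ) (hm : m = 2 ^ K) (β : ℝ) (hβ : 0 < β)
    (f : ℕ → ℕ → ℝ)
    (hconv : ∀ t ∈ Finset.Icc 1 T, ∀ a b : ℕ, a ≤ b → b + 1 ≤ m →
      f t (a + 1) - f t a ≤ f t (b + 1) - f t b)
    (hnonneg : ∀ t ∈ Finset.Icc 1 T, ∀ j : ℕ, j ≤ m → 0 ≤ f t j)
    (y : ℕ → ℕ) (hy : DOptimalK T m β f k y) :
    ∃ xs : ℕ → ℝ, COptimal T m β f xs ∧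
      ∀ t ∈ Finset.Icc 1 T,
        ((2 : ℝ) ^ k ≤ |(y t : ℝ) - xs t| ∨ (2 : ℝ) ^ k ≤ |(y (t - 1) : ℝ) - xs (t - 1)|) →
        0 ≤ ((y t : ℝ) - (y (t - 1) : ℝ)) * (xs t - xs (t - 1)) := by
  rcases le_or_gt k K with hk | hk
  · obtain ⟨x, hx, hnear⟩ := hy.exists_near hβ.le hconv (hm ▸ pow_dvd_pow 2 hk)
    have habs : ∀ t, |(y t : ℝ) - x t| < 2 ^ k := fun t => by
      have h1 : (x t : ℝ) < y t + 2 ^ k := by exact_mod_cast (hnear t).1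
      have h2 : (y t : ℝ) < x t + 2 ^ k := by exact_mod_cast (hnear t).2
      rw [abs_lt]
      constructor <;> linarith
    refine ⟨_, hx.cOptimal, fun t _ h => ?_⟩
    rcases h with h | h
    · exact absurd h (habs t).not_ge
    · exact absurd h (habs (t - 1)).not_ge
  · obtain ⟨x, hx⟩ := exists_DOptimal T m β f
    have hy0 : ∀ t ≤ T, y t = 0 := fun t ht => by
      rcases Nat.eq_zero_or_pos t with rfl | h
      · exact hy.1.1
      · have ht' := Finset.mem_Icc.mpr ⟨h, ht⟩
        refine Nat.eq_zero_of_dvd_of_lt (hy.2.1 t ht') ((hy.1.2 t ht').trans_lt ?_)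
        exact hm ▸ Nat.pow_lt_pow_right (by norm_num) hk
    refine ⟨_, hx.cOptimal, fun t ht _ => ?_⟩
    rw [Finset.mem_Icc] at ht
    simp [hy0 t ht.2, hy0 (t - 1) (by omega)]
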